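/- arXiv:2108.13716 — 2 statements merged into one kernel-verified Lean document; each statement's English description precedes it below -/
import Mathlib

section
/- Let J be a finite set of jobs, where job i has processing time p_i ≥ 0 and resource requirement r_i with 0 ≤ r_i ≤ 1. Let σ be any schedule of J (an assignment of a start time S_i ≥ 0 to each job), with total resource consumption R(t) = Σ_{i : S_i ≤ t < S_i + p_i} r_i, and suppose that R(t) ≥ 2/3 for all t in the interval [t_a, t_b), where t_a ≤ t_b. Let σ' be any resource-feasible schedule of the same jobs (an assignment of start times S'_i ≥ 0 whose total resource consumption R'(t) satisfies R'(t) ≤ 1 for all t) and let C' ≥ 0 satisfy S'_i + p_i ≤ C' for every job i. Then t_b − t_a ≤ (3/2)·C'. -/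
open Finset

/-- The total consumption, as a sum of indicator functions of the execution intervals. -/
lemma sum_filter_executed_eq_sum_indicator {ι : Type*} (J : Finset ι) (p r S : ι → ℝ) (t : ℝ) :
    ∑ i ∈ J.filter (fun i => S i ≤ t ∧ t < S i + p i), r i =
      ∑ i ∈ J, (Set.Ico (S i) (S i + p i)).indicator (fun _ => r i) t := by
  simp only [Finset.sum_filter, Set.indicator_apply, Set.mem_Ico]

lemma integrable_indicator_Ico_const (a b c : ℝ) (A : Set ℝ) :
    MeasureTheory.IntegrableOn ((Set.Ico a b).indicator fun _ => c) A := by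
  have h : MeasureTheory.Integrable ((Set.Ico a b).indicator fun _ : ℝ => c) := by
    rw [MeasureTheory.integrable_indicator_iff measurableSet_Ico]
    exact MeasureTheory.integrableOn_const measure_Ico_lt_top.ne
  exact h.integrableOn

lemma integrableOn_sum_executed {ι : Type*} (J : Finset ι) (p r S : ι → ℝ) (A : Set ℝ) :
    MeasureTheory.IntegrableOn
      (fun t => ∑ i ∈ J.filter (fun i => S i ≤ t ∧ t < S i + p i), r i) A := by
  simp only [sum_filter_executed_eq_sum_indicator]
  exact MeasureTheory.integrable_finsetSum _ fun i _ => integrable_indicator_Ico_const _ _ _ _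

/-- The resource consumed over a set `A` of times, summed job by job. -/
lemma setIntegral_sum_executed {ι : Type*} (J : Finset ι) (p r S : ι → ℝ) (A : Set ℝ) :
    ∫ t in A, ∑ i ∈ J.filter (fun i => S i ≤ t ∧ t < S i + p i), r i =
      ∑ i ∈ J, (MeasureTheory.volume.real (Set.Ico (S i) (S i + p i) ∩ A)) * r i := by
  simp only [sum_filter_executed_eq_sum_indicator]
  rw [MeasureTheory.integral_finsetSum _ fun i _ => integrable_indicator_Ico_const _ _ _ _]
  refine Finset.sum_congr rfl fun i _ => ?_
  rw [MeasureTheory.integral_indicator_const _ measurableSet_Ico,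
    MeasureTheory.measureReal_restrict_apply measurableSet_Ico, smul_eq_mul]

/-- Lemma 1: if the total resource consumption of a schedule is at least 2/3
throughout an interval `[ta, tb)`, then `tb - ta ≤ (3/2) * C'` where `C'` is the
makespan of any resource-feasible schedule of the same jobs. -/
theorem interval_of_high_consumption_le
    {ι : Type*} (J : Finset ι) (p r S S' : ι → ℝ)
    (hp : ∀ i ∈ J, 0 ≤ p i)
    (hr0 : ∀ i ∈ J, 0 ≤ r i) (hr1 : ∀ i ∈ J, r i ≤ 1)
    (hS : ∀ i ∈ J, 0 ≤ S i)
    (ta tb : ℝ) (htab : ta ≤ tb)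
    (hhigh : ∀ t, ta ≤ t → t < tb →
      (2 : ℝ) / 3 ≤ ∑ i ∈ J.filter (fun i => S i ≤ t ∧ t < S i + p i), r i)
    (hS' : ∀ i ∈ J, 0 ≤ S' i)
    (hfeas : ∀ t : ℝ, ∑ i ∈ J.filter (fun i => S' i ≤ t ∧ t < S' i + p i), r i ≤ 1)
    (C' : ℝ) (hC0 : 0 ≤ C') (hC : ∀ i ∈ J, S' i + p i ≤ C') :
    tb - ta ≤ 3 / 2 * C' := by
  have hlow : (2 : ℝ) / 3 * (tb - ta) ≤ ∑ i ∈ J, p i * r i := by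
    calc (2 : ℝ) / 3 * (tb - ta) = ∫ _ in Set.Ico ta tb, (2 : ℝ) / 3 := by
          rw [MeasureTheory.setIntegral_const, Real.volume_real_Ico_of_le htab, smul_eq_mul,
            mul_comm]
      _ ≤ ∫ t in Set.Ico ta tb, ∑ i ∈ J.filter (fun i => S i ≤ t ∧ t < S i + p i), r i :=
          MeasureTheory.setIntegral_mono_on
            (MeasureTheory.integrableOn_const measure_Ico_lt_top.ne)
            (integrableOn_sum_executed J p r S _) measurableSet_Ico
            fun t ht => hhigh t ht.1 ht.2
      _ ≤ ∑ i ∈ J, p i * r i := by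
          rw [setIntegral_sum_executed]
          refine Finset.sum_le_sum fun i hi => mul_le_mul_of_nonneg_right ?_ (hr0 i hi)
          refine (MeasureTheory.measureReal_mono Set.inter_subset_left
            measure_Ico_lt_top.ne).trans_eq ?_
          rw [Real.volume_real_Ico_of_le (by linarith [hp i hi]), add_sub_cancel_left]
  have hupp : ∑ i ∈ J, p i * r i ≤ C' := by
    calc ∑ i ∈ J, p i * r i
        = ∫ t in Set.Ico 0 C', ∑ i ∈ J.filter (fun i => S' i ≤ t ∧ t < S' i + p i), r i := by
          rw [setIntegral_sum_executed]
          refine Finset.sum_congr rfl fun i hi => ?_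
          rw [Set.inter_eq_left.2 (Set.Ico_subset_Ico (hS' i hi) (hC i hi)),
            Real.volume_real_Ico_of_le (by linarith [hp i hi]), add_sub_cancel_left]
      _ ≤ ∫ _ in Set.Ico 0 C', (1 : ℝ) :=
          MeasureTheory.setIntegral_mono_on (integrableOn_sum_executed J p r S' _)
            (MeasureTheory.integrableOn_const measure_Ico_lt_top.ne) measurableSet_Ico
            fun t _ => hfeas t
      _ = C' := by
          rw [MeasureTheory.setIntegral_const, Real.volume_real_Ico_of_le hC0, smul_eq_mul,
            mul_one, sub_zero]
  linarith
end

section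
/- Let m ≥ 2 be a natural number. Let W be a finite set of m − 1 jobs with nonnegative resource requirements r_i such that Σ_{i ∈ W} r_i < 1/6, and let U be a finite set of jobs, disjoint from W, with nonnegative resource requirements such that r_u ≤ min_{i ∈ W} r_i for every u ∈ U. Then every subset U' ⊆ U with |U'| ≤ m satisfies Σ_{i ∈ U'} r_i < 1/3. -/
open Finset

/-- Core of Proposition 1(b): if `W` consists of `m - 1` jobs of total resource
requirement less than `1/6` and every job of `U` has requirement at most the minimum
over `W`, then every subset of `U` of cardinality at most `m` has total requirement
less than `1/3`. -/
theorem Rm_unscheduled_lt_third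
    {ι : Type*} [DecidableEq ι] (m : ℕ) (hm : 2 ≤ m)
    (W U : Finset ι) (r : ι → ℝ)
    (hrW : ∀ i ∈ W, 0 ≤ r i) (hrU : ∀ i ∈ U, 0 ≤ r i)
    (hWcard : W.card = m - 1)
    (hWsum : ∑ i ∈ W, r i < 1 / 6)
    (hdisj : Disjoint W U)
    (hle : ∀ u ∈ U, ∀ i ∈ W, r u ≤ r i) :
    ∀ U' ⊆ U, U'.card ≤ m → ∑ i ∈ U', r i < 1 / 3 := by
  intro U' hU' hcard
  obtain ⟨k, rfl⟩ : ∃ k, m = k + 1 := ⟨m - 1, by omega⟩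
  simp only [Nat.add_sub_cancel] at hWcard
  have hk : (1 : ℝ) ≤ k := by exact_mod_cast Nat.le_of_succ_le_succ hm
  have hcard_real : (U'.card : ℝ) ≤ k + 1 := by exact_mod_cast hcard
  have hS : 0 ≤ ∑ i ∈ W, r i := Finset.sum_nonneg hrW
  have hbound : ∀ u ∈ U', (k : ℝ) * r u ≤ ∑ i ∈ W, r i := fun u hu => by
    simpa [hWcard] using Finset.card_nsmul_le_sum W r (r u) (hle u (hU' hu))
  have hsum : (k : ℝ) * ∑ u ∈ U', r u ≤ U'.card * ∑ i ∈ W, r i := by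
    simpa [Finset.mul_sum] using Finset.sum_le_card_nsmul U' _ _ hbound
  by_contra! hT
  nlinarith [mul_le_mul_of_nonneg_right hcard_real hS]
end
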